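/- arXiv:2502.15291 — 12 statements merged into one kernel-verified Lean document; each statement's English description precedes it below -/
import Mathlib

section
/- Let θ, θ' ∈ ℝ with (cos θ, sin θ) ≠ (cos θ', sin θ'). Set X := (0, cos θ, sin θ, 0), X' := (0, cos θ', sin θ', 0), d := X − X', and for any angle σ define T(σ) := (0, −sin σ, cos σ, 0) and 𝒩(σ) := (0, −cos σ, −sin σ, 0). Let A, B ∈ ℝ and N := A·T(θ) + B·𝒩(θ) − (1/2)(A² + B²)·𝔭 + 𝔭̃. Then ⟨d,d⟩ ≠ 0 and N − (2⟨d,N⟩/⟨d,d⟩)·d = −A·T(θ') + B·𝒩(θ') − (1/2)(A² + B²)·𝔭 + 𝔭̃. -/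
/-- The Minkowski bilinear form of signature (− + + +) on ℝ⁴. -/
noncomputable def mink (u v : Fin 4 → ℝ) : ℝ :=
  -(u 0 * v 0) + u 1 * v 1 + u 2 * v 2 + u 3 * v 3

/-- The null vector 𝔭 = (1,0,0,1). -/
noncomputable def pvec : Fin 4 → ℝ := ![1, 0, 0, 1]

/-- The null vector 𝔭̃ = (−1/2,0,0,1/2). -/
noncomputable def ptil : Fin 4 → ℝ := ![-(1/2), 0, 0, 1/2]

/-- The point X(σ) = (0, cos σ, sin σ, 0) on the unit circle. -/
noncomputable def Xvec (σ : ℝ) : Fin 4 → ℝ := ![0, Real.cos σ, Real.sin σ, 0]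

/-- The tangent vector T(σ) = (0, −sin σ, cos σ, 0). -/
noncomputable def Tvec (σ : ℝ) : Fin 4 → ℝ := ![0, -Real.sin σ, Real.cos σ, 0]

/-- The normal vector 𝒩(σ) = (0, −cos σ, −sin σ, 0). -/
noncomputable def Nvec (σ : ℝ) : Fin 4 → ℝ := ![0, -Real.cos σ, -Real.sin σ, 0]

theorem stmt1 (θ θ' A B : ℝ)
    (hne : (Real.cos θ, Real.sin θ) ≠ (Real.cos θ', Real.sin θ')) :
    mink (Xvec θ - Xvec θ') (Xvec θ - Xvec θ') ≠ 0 ∧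
    (A • Tvec θ + B • Nvec θ - ((1/2) * (A^2 + B^2)) • pvec + ptil) -
      (2 * mink (Xvec θ - Xvec θ')
            (A • Tvec θ + B • Nvec θ - ((1/2) * (A^2 + B^2)) • pvec + ptil) /
          mink (Xvec θ - Xvec θ') (Xvec θ - Xvec θ')) • (Xvec θ - Xvec θ') =
      (-A) • Tvec θ' + B • Nvec θ' - ((1/2) * (A^2 + B^2)) • pvec + ptil := by
  have h := Real.sin_sq_add_cos_sq θ
  have h' := Real.sin_sq_add_cos_sq θ'
  unfold mink Xvec Tvec Nvec pvec ptil
  generalize Real.cos θ = c at *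
  generalize Real.sin θ = s at *
  generalize Real.cos θ' = c' at *
  generalize Real.sin θ' = s' at *
  have hk : 1 - (c * c' + s * s') ≠ 0 := by
    intro hk
    apply hne
    have h1 : (c - c') ^ 2 + (s - s') ^ 2 = 0 := by linear_combination h + h' + 2 * hk
    have h2 : c - c' = 0 := by nlinarith [sq_nonneg (c - c'), sq_nonneg (s - s')]
    have h3 : s - s' = 0 := by nlinarith [sq_nonneg (c - c'), sq_nonneg (s - s')]
    rw [sub_eq_zero.mp h2, sub_eq_zero.mp h3]
  have hD : (c - c') * (c - c') + (s - s') * (s - s') = 2 * (1 - (c * c' + s * s')) := by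
    linear_combination h + h'
  have hN : (c - c') * (-(A * s) + -(B * c)) + (s - s') * (A * c + -(B * s))
      = A * (s * c' - c * s') - B * (1 - (c * c' + s * s')) := by
    linear_combination (-B) * h
  have hq : 2 * (A * (s * c' - c * s') - B * (1 - (c * c' + s * s'))) /
      (2 * (1 - (c * c' + s * s'))) = A * ((s * c' - c * s') / (1 - (c * c' + s * s'))) - B := by
    generalize 1 - (c * c' + s * s') = k at hk
    field_simp
  have e1 : (s * c' - c * s') / (1 - (c * c' + s * s')) * (c - c') = -(s + s') := by
    rw [div_mul_eq_mul_div, div_eq_iff hk]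
    linear_combination (-s') * h - s * h'
  have e2 : (s * c' - c * s') / (1 - (c * c' + s * s')) * (s - s') = c + c' := by
    rw [div_mul_eq_mul_div, div_eq_iff hk]
    linear_combination c' * h + c * h'
  constructor
  · simp [hD, hk]
  · ext i
    fin_cases i
    · simp
    · simp [hD, hN, hq]
      linear_combination (-A) * e1
    · simp [hD, hN, hq]
      linear_combination (-A) * e2
    · simp
end

section
/- Let θ_i, θ_j, θ_k, θ_l ∈ ℝ and set X_ι := (0, cos θ_ι, sin θ_ι, 0) ∈ ℝ^{3,1} for ι ∈ {i,j,k,l}; assume that cyclically consecutive vertices are distinct, i.e., X_i ≠ X_j, X_j ≠ X_k, X_k ≠ X_l, X_l ≠ X_i. For distinct vertices X, X' and N ∈ ℝ^{3,1}, define the propagation P(X, X', N) := N − (2⟨X − X', N⟩/⟨X − X', X − X'⟩)·(X − X'). Then for every N ∈ ℝ^{3,1} with ⟨N,N⟩ = 0 and ⟨N,𝔭⟩ = 1, propagating around the quadrilateral is consistent: P(X_l, X_i, P(X_k, X_l, P(X_j, X_k, P(X_i, X_j, N)))) = N. -/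
/-- The propagation of a lightlike Gauss map along an edge from vertex X to vertex X'. -/
noncomputable def propg (X X' N : Fin 4 → ℝ) : Fin 4 → ℝ :=
  N - (2 * mink (X - X') N / mink (X - X') (X - X')) • (X - X')

/-- The propagation acts on the middle coordinates as the reflection of angle a + b. -/
lemma propg_eq (a b : ℝ) (h : Xvec a ≠ Xvec b) (N : Fin 4 → ℝ) :
    propg (Xvec a) (Xvec b) N =
      ![N 0, Real.cos (a + b) * N 1 + Real.sin (a + b) * N 2,
        Real.sin (a + b) * N 1 - Real.cos (a + b) * N 2, N 3] := by
  have ha := Real.sin_sq_add_cos_sq a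
  have hb := Real.sin_sq_add_cos_sq b
  have hD : (Real.cos a - Real.cos b) * (Real.cos a - Real.cos b)
      + (Real.sin a - Real.sin b) * (Real.sin a - Real.sin b) ≠ 0 := by
    intro h0
    apply h
    have h1 : Real.cos a = Real.cos b := by nlinarith
    have h2 : Real.sin a = Real.sin b := by nlinarith
    simp [Xvec, h1, h2]
  ext i
  simp only [propg, mink, Xvec, Real.cos_add, Real.sin_add]
  generalize Real.cos a = c at *
  generalize Real.cos b = c' at *
  generalize Real.sin a = s at *
  generalize Real.sin b = s' at *
  fin_cases i
  · simp
  · simp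
    field_simp
    grind
  · simp
    field_simp
    grind
  · simp

theorem stmt2 (θi θj θk θl : ℝ)
    (hij : Xvec θi ≠ Xvec θj) (hjk : Xvec θj ≠ Xvec θk)
    (hkl : Xvec θk ≠ Xvec θl) (hli : Xvec θl ≠ Xvec θi) :
    ∀ N : Fin 4 → ℝ, mink N N = 0 → mink N pvec = 1 →
      propg (Xvec θl) (Xvec θi)
        (propg (Xvec θk) (Xvec θl)
          (propg (Xvec θj) (Xvec θk)
            (propg (Xvec θi) (Xvec θj) N))) = N := by
  intro N _ _
  rw [propg_eq _ _ hij, propg_eq _ _ hjk, propg_eq _ _ hkl, propg_eq _ _ hli]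
  have e : θl + θi = (θk + θl) - (θj + θk) + (θi + θj) := by ring
  rw [e]
  generalize θk + θl = B
  generalize θj + θk = C
  generalize θi + θj = D
  have hB := Real.sin_sq_add_cos_sq B
  have hC := Real.sin_sq_add_cos_sq C
  have hD := Real.sin_sq_add_cos_sq D
  ext i
  simp only [Real.cos_add, Real.sin_add, Real.cos_sub, Real.sin_sub]
  fin_cases i
  · simp
  · simp
    grind
  · simp
    grind
  · simp
end

section
/- Let x₁, x₂, x₃, x₄ ∈ ℝ² be pairwise distinct and concircular, and let ℓ_ι, ℓ'_ι ∈ ℝ (ι = 1,…,4) be such that the four points (ℓ_ι, x_ι) ∈ ℝ³ are coplanar and the four points (ℓ'_ι, x_ι) ∈ ℝ³ are coplanar. Then the four points (ℓ_ι + ℓ'_ι, x_ι) ∈ ℝ³ are coplanar. (Consequently, the sum as graphs of two circular nets in isotropic 3-space with the same projection is again a circular net, and the sum of two discrete isothermic surfaces with the same projection is discrete isothermic.) -/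
/-- The Euclidean norm on ℝ². -/
noncomputable def enorm2 (v : ℝ × ℝ) : ℝ := Real.sqrt (v.1 ^ 2 + v.2 ^ 2)

/-- Four points of ℝ³ are coplanar if they lie on a common affine plane
    ⟨n, ·⟩ = d with n ≠ 0. -/
def Coplanar4 (P1 P2 P3 P4 : ℝ × ℝ × ℝ) : Prop :=
  ∃ n : ℝ × ℝ × ℝ, n ≠ 0 ∧ ∃ d : ℝ,
    n.1 * P1.1 + n.2.1 * P1.2.1 + n.2.2 * P1.2.2 = d ∧
    n.1 * P2.1 + n.2.1 * P2.2.1 + n.2.2 * P2.2.2 = d ∧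
    n.1 * P3.1 + n.2.1 * P3.2.1 + n.2.2 * P3.2.2 = d ∧
    n.1 * P4.1 + n.2.1 * P4.2.1 + n.2.2 * P4.2.2 = d

/-- Four points of ℝ² are concircular if they lie on a common circle of
    positive radius. -/
def Concircular4 (x1 x2 x3 x4 : ℝ × ℝ) : Prop :=
  ∃ c : ℝ × ℝ, ∃ r : ℝ, 0 < r ∧
    enorm2 (x1 - c) = r ∧ enorm2 (x2 - c) = r ∧
    enorm2 (x3 - c) = r ∧ enorm2 (x4 - c) = r

theorem enorm2_sq {v : ℝ × ℝ} {r : ℝ} (h : enorm2 v = r) : v.1 ^ 2 + v.2 ^ 2 = r ^ 2 := by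
  rw [← h, enorm2, Real.sq_sqrt (by positivity)]

theorem line_circle (x y z c : ℝ × ℝ) (r a b d : ℝ)
    (hxy : x ≠ y) (hxz : x ≠ z) (hyz : y ≠ z)
    (hx : enorm2 (x - c) = r) (hy : enorm2 (y - c) = r) (hz : enorm2 (z - c) = r)
    (lx : a * x.1 + b * x.2 = d) (ly : a * y.1 + b * y.2 = d) (lz : a * z.1 + b * z.2 = d) :
    a = 0 ∧ b = 0 := by
  by_contra hab
  have he : a ^ 2 + b ^ 2 ≠ 0 := by
    intro h
    apply hab
    constructor <;> nlinarith [sq_nonneg a, sq_nonneg b]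
  have hx := enorm2_sq hx
  have hy := enorm2_sq hy
  have hz := enorm2_sq hz
  obtain ⟨x1, x2⟩ := x
  obtain ⟨y1, y2⟩ := y
  obtain ⟨z1, z2⟩ := z
  obtain ⟨c1, c2⟩ := c
  simp only [Prod.mk_sub_mk] at *
  -- a point of the line is determined by its coordinate along the line
  have key : ∀ p1 p2 q1 q2 : ℝ, a * p1 + b * p2 = d → a * q1 + b * q2 = d →
      a * p2 - b * p1 = a * q2 - b * q1 → ((p1, p2) : ℝ × ℝ) = (q1, q2) := by
    intro p1 p2 q1 q2 h1 h2 h3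
    have e1 : p1 = q1 := by
      apply mul_left_cancel₀ he
      linear_combination a * h1 - a * h2 - b * h3
    have e2 : p2 = q2 := by
      apply mul_left_cancel₀ he
      linear_combination b * h1 - b * h2 + a * h3
    rw [e1, e2]
  -- on the circle the coordinates of two distinct points have a fixed sum
  have key2 : ∀ p1 p2 q1 q2 : ℝ, a * p1 + b * p2 = d → a * q1 + b * q2 = d →
      (p1 - c1) ^ 2 + (p2 - c2) ^ 2 = r ^ 2 → (q1 - c1) ^ 2 + (q2 - c2) ^ 2 = r ^ 2 →
      ((p1, p2) : ℝ × ℝ) ≠ (q1, q2) →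
      (a * p2 - b * p1) + (a * q2 - b * q1) = 2 * (a * c2 - b * c1) := by
    intro p1 p2 q1 q2 h1 h2 h3 h4 hne
    have hT : (a * p2 - b * p1) - (a * q2 - b * q1) ≠ 0 := fun h =>
      hne (key _ _ _ _ h1 h2 (sub_eq_zero.mp h))
    apply mul_left_cancel₀ hT
    linear_combination (a ^ 2 + b ^ 2) * (h3 - h4) -
      (a * p1 + b * p2 + a * q1 + b * q2 - 2 * (a * c1 + b * c2)) * (h1 - h2)
  have s1 := key2 _ _ _ _ lx ly hx hy hxy
  have s2 := key2 _ _ _ _ lx lz hx hz hxz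
  exact hyz (key _ _ _ _ ly lz (by linarith))

theorem stmt4 (x1 x2 x3 x4 : ℝ × ℝ) (l1 l2 l3 l4 l1' l2' l3' l4' : ℝ)
    (h12 : x1 ≠ x2) (h13 : x1 ≠ x3) (h14 : x1 ≠ x4)
    (h23 : x2 ≠ x3) (h24 : x2 ≠ x4) (h34 : x3 ≠ x4)
    (hconc : Concircular4 x1 x2 x3 x4)
    (hplane : Coplanar4 (l1, x1.1, x1.2) (l2, x2.1, x2.2) (l3, x3.1, x3.2) (l4, x4.1, x4.2))
    (hplane' : Coplanar4 (l1', x1.1, x1.2) (l2', x2.1, x2.2) (l3', x3.1, x3.2) (l4', x4.1, x4.2)) :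
    Coplanar4 (l1 + l1', x1.1, x1.2) (l2 + l2', x2.1, x2.2)
      (l3 + l3', x3.1, x3.2) (l4 + l4', x4.1, x4.2) := by
  obtain ⟨c, r, hr, c1, c2, c3, c4⟩ := hconc
  obtain ⟨⟨n, a, b⟩, hn, d, p1, p2, p3, p4⟩ := hplane
  obtain ⟨⟨m, a', b'⟩, hm, d', q1, q2, q3, q4⟩ := hplane'
  simp only at p1 p2 p3 p4 q1 q2 q3 q4
  have hn0 : n ≠ 0 := by
    rintro rfl
    obtain ⟨rfl, rfl⟩ := line_circle x1 x2 x3 c r a b d h12 h13 h23 c1 c2 c3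
      (by linarith) (by linarith) (by linarith)
    exact hn rfl
  have hm0 : m ≠ 0 := by
    rintro rfl
    obtain ⟨rfl, rfl⟩ := line_circle x1 x2 x3 c r a' b' d' h12 h13 h23 c1 c2 c3
      (by linarith) (by linarith) (by linarith)
    exact hm rfl
  refine ⟨(n * m, m * a + n * a', m * b + n * b'), ?_, m * d + n * d', ?_, ?_, ?_, ?_⟩
  · intro h
    exact mul_ne_zero hn0 hm0 (congrArg Prod.fst h)
  · linear_combination m * p1 + n * q1
  · linear_combination m * p2 + n * q2
  · linear_combination m * p3 + n * q3
  · linear_combination m * p4 + n * q4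
end

section
/- Let a, b ∈ ℝ with a ≠ 0, b ≠ 0, and let g_i, g_j, g_k, g_l ∈ ℂ be pairwise distinct with cr(g_i, g_j, g_k, g_l) = b/a. Then 1/(a(g_i − g_j)) + 1/(b(g_j − g_k)) + 1/(a(g_k − g_l)) + 1/(b(g_l − g_i)) = 0; that is, the Christoffel-dual discrete 1-form ω with ω_{ij} := 1/(m_{ij}(g_i − g_j)) (where m_{ij} = m_{lk} = a and m_{jk} = m_{il} = b are the edge labels) is closed around the quadrilateral. -/
/-- The cross-ratio of four complex numbers. -/
noncomputable def cr (a b c d : ℂ) : ℂ := ((a - b) * (c - d)) / ((b - c) * (d - a))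

theorem stmt6 (a b : ℝ) (ha : a ≠ 0) (hb : b ≠ 0) (gi gj gk gl : ℂ)
    (hij : gi ≠ gj) (hik : gi ≠ gk) (hil : gi ≠ gl)
    (hjk : gj ≠ gk) (hjl : gj ≠ gl) (hkl : gk ≠ gl)
    (hcr : cr gi gj gk gl = (b : ℂ) / (a : ℂ)) :
    1 / ((a : ℂ) * (gi - gj)) + 1 / ((b : ℂ) * (gj - gk)) +
      1 / ((a : ℂ) * (gk - gl)) + 1 / ((b : ℂ) * (gl - gi)) = 0 := by
  have ha' : (a : ℂ) ≠ 0 := by exact_mod_cast ha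
  have hb' : (b : ℂ) ≠ 0 := by exact_mod_cast hb
  have hp : gi - gj ≠ 0 := sub_ne_zero.mpr hij
  have hq : gj - gk ≠ 0 := sub_ne_zero.mpr hjk
  have hr : gk - gl ≠ 0 := sub_ne_zero.mpr hkl
  have hs : gl - gi ≠ 0 := sub_ne_zero.mpr hil.symm
  unfold cr at hcr
  rw [div_eq_div_iff (mul_ne_zero hq hs) ha'] at hcr
  have h1 : 1 / ((a : ℂ) * (gi - gj)) + 1 / ((a : ℂ) * (gk - gl)) =
      ((gi - gj) + (gk - gl)) / ((gi - gj) * (gk - gl) * a) := by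
    rw [div_add_div _ _ (mul_ne_zero ha' hp) (mul_ne_zero ha' hr),
      div_eq_div_iff (mul_ne_zero (mul_ne_zero ha' hp) (mul_ne_zero ha' hr))
        (mul_ne_zero (mul_ne_zero hp hr) ha')]
    ring
  have h2 : 1 / ((b : ℂ) * (gj - gk)) + 1 / ((b : ℂ) * (gl - gi)) =
      ((gj - gk) + (gl - gi)) / (b * ((gj - gk) * (gl - gi))) := by
    rw [div_add_div _ _ (mul_ne_zero hb' hq) (mul_ne_zero hb' hs),
      div_eq_div_iff (mul_ne_zero (mul_ne_zero hb' hq) (mul_ne_zero hb' hs))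
        (mul_ne_zero hb' (mul_ne_zero hq hs))]
    ring
  rw [hcr] at h1
  linear_combination h1 + h2
end

section
/- Let a, b ∈ ℝ \ {0}, H ∈ ℝ \ {0}, and let g_i, g_j, g_k, g_l ∈ ℂ be pairwise distinct with cr(g_i, g_j, g_k, g_l) = b/a. Fix h_i ∈ ℂ arbitrarily and define h_j := h_i − H/(a(g_i − g_j)), h_k := h_j − H/(b(g_j − g_k)), h_l := h_k − H/(a(g_k − g_l)). Then h_j ≠ h_k and h_l ≠ h_i, and cr(h_i, h_j, h_k, h_l) = b/a = cr(g_i, g_j, g_k, g_l); in particular, h is again a discrete holomorphic quadrilateral with factorized cross-ratio. -/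
theorem stmt7 (a b H : ℝ) (ha : a ≠ 0) (hb : b ≠ 0) (hH : H ≠ 0)
    (gi gj gk gl : ℂ)
    (hij : gi ≠ gj) (hik : gi ≠ gk) (hil : gi ≠ gl)
    (hjk : gj ≠ gk) (hjl : gj ≠ gl) (hkl : gk ≠ gl)
    (hcr : cr gi gj gk gl = (b : ℂ) / (a : ℂ))
    (hi hj hk hl : ℂ)
    (hhj : hj = hi - (H : ℂ) / ((a : ℂ) * (gi - gj)))
    (hhk : hk = hj - (H : ℂ) / ((b : ℂ) * (gj - gk)))
    (hhl : hl = hk - (H : ℂ) / ((a : ℂ) * (gk - gl))) :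
    hj ≠ hk ∧ hl ≠ hi ∧ cr hi hj hk hl = (b : ℂ) / (a : ℂ) := by
  have hA : (a : ℂ) ≠ 0 := by exact_mod_cast ha
  have hB : (b : ℂ) ≠ 0 := by exact_mod_cast hb
  have hC : (H : ℂ) ≠ 0 := by exact_mod_cast hH
  unfold cr at *
  generalize (a : ℂ) = A at *
  generalize (b : ℂ) = B at *
  generalize (H : ℂ) = C at *
  have hp : gi - gj ≠ 0 := sub_ne_zero.mpr hij
  have hq : gj - gk ≠ 0 := sub_ne_zero.mpr hjk
  have hr : gk - gl ≠ 0 := sub_ne_zero.mpr hkl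
  have hs : gl - gi ≠ 0 := sub_ne_zero.mpr hil.symm
  have hsum : gl - gi = -((gi - gj) + (gj - gk) + (gk - gl)) := by ring
  generalize gi - gj = p at *
  generalize gj - gk = q at *
  generalize gk - gl = r at *
  generalize gl - gi = s at *
  have key : A * (p * r) = B * (q * s) := by
    rw [div_eq_div_iff (mul_ne_zero hq hs) hA] at hcr
    linear_combination hcr
  have e1 : hi - hj = C / (A * p) := by rw [hhj]; ring
  have e2 : hj - hk = C / (B * q) := by rw [hhk]; ring
  have e3 : hk - hl = C / (A * r) := by rw [hhl]; ring
  have h0 : 1 / (A * p) + 1 / (A * r) + 1 / (B * q) + 1 / (B * s) = 0 := by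
    have h1 : 1 / (A * p) + 1 / (A * r) = (p + r) / (A * (p * r)) := by
      field_simp
      ring
    have h2 : 1 / (B * q) + 1 / (B * s) = (q + s) / (B * (q * s)) := by
      field_simp
      ring
    rw [add_assoc, h1, h2, key, ← add_div, hsum]
    ring
  have e4 : hl - hi = C / (B * s) := by
    linear_combination -e1 - e2 - e3 - C * h0
  refine ⟨?_, ?_, ?_⟩
  · rw [← sub_ne_zero, e2]
    exact div_ne_zero hC (mul_ne_zero hB hq)
  · rw [← sub_ne_zero, e4]
    exact div_ne_zero hC (mul_ne_zero hB hs)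
  · rw [e1, e2, e3, e4]
    clear hsum hcr h0 e1 e2 e3 e4 hhj hhk hhl
    field_simp
    linear_combination -key
end

section
/- Let a, b ∈ ℝ \ {0}, H ∈ ℝ \ {0}, and let g_i, g_j, g_k, g_l ∈ ℂ be pairwise distinct with cr(g_i, g_j, g_k, g_l) = b/a. Fix h_i ∈ ℂ and define h_j := h_i − H/(a(g_i − g_j)), h_k := h_j − H/(b(g_j − g_k)), h_l := h_k − H/(a(g_k − g_l)). Then the mixed area of the quadrilateral h = (h_i, h_j, h_k, h_l) and the complex-conjugated quadrilateral ḡ = (ḡ_i, ḡ_j, ḡ_k, ḡ_l) vanishes: A(h, ḡ) = 0. -/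
/-- The wedge product z ∧ w = Im(z̄·w) on ℂ ≅ ℝ². -/
noncomputable def wedge (z w : ℂ) : ℝ := ((starRingEnd ℂ) z * w).im

/-- The mixed area of two quadrilaterals (x_i,x_j,x_k,x_l) and (y_i,y_j,y_k,y_l) in ℂ ≅ ℝ². -/
noncomputable def mixedArea (xi xj xk xl yi yj yk yl : ℂ) : ℝ :=
  (1 / 4) * (wedge (xi - xk) (yj - yl) - wedge (xj - xl) (yi - yk))

theorem stmt8 (a b H : ℝ) (ha : a ≠ 0) (hb : b ≠ 0) (hH : H ≠ 0)
    (gi gj gk gl : ℂ)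
    (hij : gi ≠ gj) (hik : gi ≠ gk) (hil : gi ≠ gl)
    (hjk : gj ≠ gk) (hjl : gj ≠ gl) (hkl : gk ≠ gl)
    (hcr : cr gi gj gk gl = (b : ℂ) / (a : ℂ))
    (hi hj hk hl : ℂ)
    (hhj : hj = hi - (H : ℂ) / ((a : ℂ) * (gi - gj)))
    (hhk : hk = hj - (H : ℂ) / ((b : ℂ) * (gj - gk)))
    (hhl : hl = hk - (H : ℂ) / ((a : ℂ) * (gk - gl))) :
    mixedArea hi hj hk hl
      ((starRingEnd ℂ) gi) ((starRingEnd ℂ) gj) ((starRingEnd ℂ) gk) ((starRingEnd ℂ) gl)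
      = 0 := by
  have h1 : gi - gj ≠ 0 := sub_ne_zero.mpr hij
  have h2 : gj - gk ≠ 0 := sub_ne_zero.mpr hjk
  have h3 : gk - gl ≠ 0 := sub_ne_zero.mpr hkl
  have h4 : gl - gi ≠ 0 := sub_ne_zero.mpr hil.symm
  have ha' : (a : ℂ) ≠ 0 := by exact_mod_cast ha
  have hb' : (b : ℂ) ≠ 0 := by exact_mod_cast hb
  unfold cr at hcr
  rw [div_eq_div_iff (mul_ne_zero h2 h4) ha'] at hcr
  have hq : (H : ℂ) / ((b : ℂ) * (gj - gk))
      = H * (gl - gi) / (a * (gi - gj) * (gk - gl)) := by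
    rw [div_eq_div_iff (mul_ne_zero hb' h2) (mul_ne_zero (mul_ne_zero ha' h1) h3)]
    linear_combination (H : ℂ) * hcr
  have key : (hi - hk) * (gj - gl) - (hj - hl) * (gi - gk) = 0 := by
    rw [hhl, hhk, hhj, hq]
    field_simp
    ring
  have hw : ∀ z u v : ℂ, wedge z ((starRingEnd ℂ) u - (starRingEnd ℂ) v)
      = -(z * (u - v)).im := by
    intro z u v
    unfold wedge
    rw [← map_sub, ← map_mul, Complex.conj_im]
  unfold mixedArea
  rw [hw, hw]
  have := congrArg Complex.im key
  rw [Complex.sub_im, Complex.zero_im] at this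
  linarith
end

section
/- Let a, b ∈ ℝ \ {0}, H ∈ ℝ \ {0}, and let g_i, g_j, g_k, g_l ∈ ℂ be pairwise distinct with cr(g_i, g_j, g_k, g_l) = b/a. Fix h_i ∈ ℂ and define h_j := h_i − H/(a(g_i − g_j)), h_k := h_j − H/(b(g_j − g_k)), h_l := h_k − H/(a(g_k − g_l)). For each oriented edge (u,v) ∈ {(i,j),(j,k),(k,l),(l,i)} define δ(u,v) := (1/H)·( Re( ((h̄_u + h̄_v)/2 + (g_u + g_v)/2)·(h_u − h_v) ), Re(h_u − h_v), Re(−𝕚·(h_u − h_v)) ) ∈ ℝ³. Then δ(i,j) + δ(j,k) + δ(k,l) + δ(l,i) = 0; that is, the discrete Weierstrass 1-form dY_{uv} = Re((h̄_{uv} + g_{uv}, 1, −𝕚)·ω_{uv}) is closed around the quadrilateral, so it defines a discrete surface Y in isotropic 3-space. -/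
/-- The discrete Weierstrass 1-form for a cmc-H surface in isotropic 3-space,
    evaluated on an oriented edge (u,v) with data (h, g):
    (1/H)·( Re((h̄_{uv} + g_{uv})·dh_{uv}), Re dh_{uv}, Re(−𝕚·dh_{uv}) ). -/
noncomputable def wform (H : ℝ) (hu hv gu gv : ℂ) : ℝ × ℝ × ℝ :=
  (1 / H) •
    (((((starRingEnd ℂ) hu + (starRingEnd ℂ) hv) / 2 + (gu + gv) / 2) * (hu - hv)).re,
      (hu - hv).re, (-Complex.I * (hu - hv)).re)

theorem stmt9 (a b H : ℝ) (ha : a ≠ 0) (hb : b ≠ 0) (hH : H ≠ 0)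
    (gi gj gk gl : ℂ)
    (hij : gi ≠ gj) (hik : gi ≠ gk) (hil : gi ≠ gl)
    (hjk : gj ≠ gk) (hjl : gj ≠ gl) (hkl : gk ≠ gl)
    (hcr : cr gi gj gk gl = (b : ℂ) / (a : ℂ))
    (hi hj hk hl : ℂ)
    (hhj : hj = hi - (H : ℂ) / ((a : ℂ) * (gi - gj)))
    (hhk : hk = hj - (H : ℂ) / ((b : ℂ) * (gj - gk)))
    (hhl : hl = hk - (H : ℂ) / ((a : ℂ) * (gk - gl))) :
    wform H hi hj gi gj + wform H hj hk gj gk +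
      wform H hk hl gk gl + wform H hl hi gl gi = 0 := by
  have hp : gi - gj ≠ 0 := sub_ne_zero.mpr hij
  have hq : gj - gk ≠ 0 := sub_ne_zero.mpr hjk
  have hr : gk - gl ≠ 0 := sub_ne_zero.mpr hkl
  have hs : gl - gi ≠ 0 := sub_ne_zero.mpr hil.symm
  have ha' : (a : ℂ) ≠ 0 := by exact_mod_cast ha
  have hb' : (b : ℂ) ≠ 0 := by exact_mod_cast hb
  have key : (gi - gj) * (gk - gl) * a = b * ((gj - gk) * (gl - gi)) := by
    unfold cr at hcr
    exact (div_eq_div_iff (mul_ne_zero hq hs) ha').mp hcr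
  obtain ⟨X, hX⟩ : ∃ X : ℂ, X = (H : ℂ) / ((gi - gj) * (gk - gl) * a) := ⟨_, rfl⟩
  have e1 : (H : ℂ) / ((a : ℂ) * (gi - gj)) = X * (gk - gl) := by
    rw [hX]; field_simp
  have e3 : (H : ℂ) / ((a : ℂ) * (gk - gl)) = X * (gi - gj) := by
    rw [hX]; field_simp
  have e2 : (H : ℂ) / ((b : ℂ) * (gj - gk)) = X * (gl - gi) := by
    rw [hX, key]; field_simp
  rw [e1] at hhj
  rw [e2] at hhk
  rw [e3] at hhl
  subst hhj
  subst hhk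
  subst hhl
  unfold wform
  rw [← smul_add, ← smul_add, ← smul_add]
  refine smul_eq_zero_of_right _ ?_
  refine Prod.ext ?_ (Prod.ext ?_ ?_)
  all_goals
    simp
    ring
end

section
/- Let a, b ∈ ℝ \ {0}, H ∈ ℝ \ {0}, and let g_i, g_j, g_k, g_l ∈ ℂ be pairwise distinct with cr(g_i, g_j, g_k, g_l) = b/a. Fix h_i ∈ ℂ and define h_j := h_i − H/(a(g_i − g_j)), h_k := h_j − H/(b(g_j − g_k)), h_l := h_k − H/(a(g_k − g_l)). Define x_ι := h_ι/H and n_ι := −h_ι − ḡ_ι for ι ∈ {i,j,k,l}. Then A(x, n) + H·A(x, x) = 0; that is, the discrete isothermic surface Y given by the discrete Weierstrass representation dY = Re((h̄ + g, 1, −𝕚)ω) with ω = dh/H has constant mean curvature H on the quadrilateral, where x is the orthoprojection of Y to ℝ² and n the orthoprojection of its Gauss map. -/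
theorem stmt11 (a b H : ℝ) (ha : a ≠ 0) (hb : b ≠ 0) (hH : H ≠ 0)
    (gi gj gk gl : ℂ)
    (hij : gi ≠ gj) (hik : gi ≠ gk) (hil : gi ≠ gl)
    (hjk : gj ≠ gk) (hjl : gj ≠ gl) (hkl : gk ≠ gl)
    (hcr : cr gi gj gk gl = (b : ℂ) / (a : ℂ))
    (hi hj hk hl : ℂ)
    (hhj : hj = hi - (H : ℂ) / ((a : ℂ) * (gi - gj)))
    (hhk : hk = hj - (H : ℂ) / ((b : ℂ) * (gj - gk)))
    (hhl : hl = hk - (H : ℂ) / ((a : ℂ) * (gk - gl))) :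
    let xi : ℂ := hi / (H : ℂ); let xj : ℂ := hj / (H : ℂ)
    let xk : ℂ := hk / (H : ℂ); let xl : ℂ := hl / (H : ℂ)
    let ni : ℂ := -hi - (starRingEnd ℂ) gi; let nj : ℂ := -hj - (starRingEnd ℂ) gj
    let nk : ℂ := -hk - (starRingEnd ℂ) gk; let nl : ℂ := -hl - (starRingEnd ℂ) gl
    mixedArea xi xj xk xl ni nj nk nl + H * mixedArea xi xj xk xl xi xj xk xl = 0 := by
  intro xi xj xk xl ni nj nk nl
  have haC : (a : ℂ) ≠ 0 := by exact_mod_cast ha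
  have hbC : (b : ℂ) ≠ 0 := by exact_mod_cast hb
  have h1 : gi - gj ≠ 0 := sub_ne_zero.mpr hij
  have h2 : gj - gk ≠ 0 := sub_ne_zero.mpr hjk
  have h3 : gk - gl ≠ 0 := sub_ne_zero.mpr hkl
  have h4 : gl - gi ≠ 0 := sub_ne_zero.mpr hil.symm
  unfold cr at hcr
  rw [div_eq_div_iff (mul_ne_zero h2 h4) haC] at hcr
  have key : (hi - hk) * (gj - gl) - (hj - hl) * (gi - gk) = 0 := by
    have e1 : hi - hk = H / (a * (gi - gj)) + H / (b * (gj - gk)) := by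
      rw [hhk, hhj]; ring
    have e2 : hj - hl = H / (b * (gj - gk)) + H / (a * (gk - gl)) := by
      rw [hhl, hhk]; ring
    have e3 : (H : ℂ) / (b * (gj - gk)) = H * (gl - gi) / (a * (gi - gj) * (gk - gl)) := by
      rw [div_eq_div_iff (mul_ne_zero hbC h2) (mul_ne_zero (mul_ne_zero haC h1) h3)]
      linear_combination (H : ℂ) * hcr
    rw [e1, e2, e3]
    field_simp
    ring
  have kim := congrArg Complex.im key
  simp only [Complex.sub_im, Complex.mul_im, Complex.sub_re, Complex.zero_im] at kim
  simp only [mixedArea, wedge, xi, xj, xk, xl, ni, nj, nk, nl, Complex.mul_im, Complex.conj_re,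
    Complex.conj_im, Complex.sub_re, Complex.sub_im, Complex.neg_re, Complex.neg_im,
    Complex.div_ofReal_re, Complex.div_ofReal_im]
  field_simp
  linear_combination kim
end

section
/- Let H ∈ ℝ \ {0}, M ∈ ℤ \ {0}, and N a positive integer. Define g(m,n) := H(m + 𝕚 n)/M and h(m,n) := H(m + 𝕚 n)/N for (m,n) ∈ ℤ². Then: (i) on every horizontal edge, h(m,n) − h(m+1,n) = H/((MN/H)·(g(m,n) − g(m+1,n))), and on every vertical edge, h(m,n) − h(m,n+1) = H/((−MN/H)·(g(m,n) − g(m,n+1))); (ii) the map Y(m,n) := ( (H/(2M))·((M+N)(m/N)² + (M−N)(n/N)²), m/N, n/N ) ∈ ℝ³ satisfies, on every horizontal edge, Y(m,n) − Y(m+1,n) = (1/H)·( Re(c_e·δ), Re δ, Re(−𝕚 δ) ) with δ := h(m,n) − h(m+1,n) and c_e := conj((h(m,n) + h(m+1,n))/2) + (g(m,n) + g(m+1,n))/2, and the analogous identity holds on every vertical edge. In particular, Y(m,n) − Y(m+1,n) = −( H(M+N)(2m+1)/(2MN²), 1/N, 0 ) and Y(m,n) − Y(m,n+1) = −( H(M−N)(2n+1)/(2MN²),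 0, 1/N ); so Y is the closed-form parametrization of a doubly channel discrete cmc-H surface. -/
theorem stmt13 (H : ℝ) (hH : H ≠ 0) (M N : ℤ) (hM : M ≠ 0) (hN : 0 < N) :
    let g : ℤ → ℤ → ℂ := fun m n => (H : ℂ) * ((m : ℂ) + Complex.I * (n : ℂ)) / (M : ℂ)
    let h : ℤ → ℤ → ℂ := fun m n => (H : ℂ) * ((m : ℂ) + Complex.I * (n : ℂ)) / (N : ℂ)
    let Y : ℤ → ℤ → ℝ × ℝ × ℝ := fun m n =>
      (H / (2 * (M : ℝ)) *
          (((M : ℝ) + (N : ℝ)) * ((m : ℝ) / (N : ℝ)) ^ 2 +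
            ((M : ℝ) - (N : ℝ)) * ((n : ℝ) / (N : ℝ)) ^ 2),
        (m : ℝ) / (N : ℝ), (n : ℝ) / (N : ℝ))
    ∀ m n : ℤ,
      (h m n - h (m + 1) n =
        (H : ℂ) / ((((M : ℝ) * (N : ℝ) / H : ℝ) : ℂ) * (g m n - g (m + 1) n))) ∧
      (h m n - h m (n + 1) =
        (H : ℂ) / (((-((M : ℝ) * (N : ℝ) / H) : ℝ) : ℂ) * (g m n - g m (n + 1)))) ∧
      (Y m n - Y (m + 1) n = wform H (h m n) (h (m + 1) n) (g m n) (g (m + 1) n)) ∧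
      (Y m n - Y m (n + 1) = wform H (h m n) (h m (n + 1)) (g m n) (g m (n + 1))) ∧
      (Y m n - Y (m + 1) n =
        -(H * ((M : ℝ) + (N : ℝ)) * (2 * (m : ℝ) + 1) / (2 * (M : ℝ) * (N : ℝ) ^ 2),
          1 / (N : ℝ), (0 : ℝ))) ∧
      (Y m n - Y m (n + 1) =
        -(H * ((M : ℝ) - (N : ℝ)) * (2 * (n : ℝ) + 1) / (2 * (M : ℝ) * (N : ℝ) ^ 2),
          (0 : ℝ), 1 / (N : ℝ))) := by
  intro g h Y m n
  have hM' : (M : ℝ) ≠ 0 := by exact_mod_cast hM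
  have hN' : (N : ℝ) ≠ 0 := by exact_mod_cast hN.ne'
  have hMc : (M : ℂ) ≠ 0 := by exact_mod_cast hM
  have hNc : (N : ℂ) ≠ 0 := by exact_mod_cast hN.ne'
  have hHc : (H : ℂ) ≠ 0 := by exact_mod_cast hH
  have key : ∀ (K : ℤ) (a b : ℤ), (H : ℂ) * ((a : ℂ) + Complex.I * (b : ℂ)) / (K : ℂ)
      = ⟨H * a / K, H * b / K⟩ := by
    intro K a b
    rw [Complex.mk_eq_add_mul_I]
    push_cast
    ring
  have gk : ∀ a b, g a b = ⟨H * a / M, H * b / M⟩ := key M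
  have hk : ∀ a b, h a b = ⟨H * a / N, H * b / N⟩ := key N
  refine ⟨?_, ?_, ?_, ?_, ?_, ?_⟩
  · have h1 : h m n - h (m + 1) n = -(H : ℂ) / N := by
      simp only [h]; push_cast; ring
    have h2 : g m n - g (m + 1) n = -(H : ℂ) / M := by
      simp only [g]; push_cast; ring
    rw [h1, h2]
    push_cast
    field_simp
  · have h1 : h m n - h m (n + 1) = -(Complex.I * (H : ℂ)) / N := by
      simp only [h]; push_cast; ring
    have h2 : g m n - g m (n + 1) = -(Complex.I * (H : ℂ)) / M := by
      simp only [g]; push_cast; ring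
    rw [h1, h2]
    push_cast
    have hI : Complex.I ≠ 0 := Complex.I_ne_zero
    field_simp
    simp
  · rw [hk, hk, gk, gk]
    ext <;> simp [Y, wform] <;> field_simp <;> ring
  · rw [hk, hk, gk, gk]
    ext <;> simp [Y, wform] <;> field_simp <;> ring
  · ext <;> simp [Y] <;> field_simp <;> ring
  · ext <;> simp [Y] <;> field_simp <;> ring
end

section
/- Let N ∈ ℤ with N ≥ 2, set β := π/N, let α ≥ 0 be the real number with cosh α = 2 − cos β, and let c, H ∈ ℝ \ {0}. Define g(m,n) := c·e^{−αm}(cos(βn) + 𝕚 sin(βn)) and h(m,n) := H·e^{αm}(cos(βn) − 𝕚 sin(βn)) for (m,n) ∈ ℤ². Then on every horizontal edge, h(m,n) − h(m+1,n) = H/(m_h·(g(m,n) − g(m+1,n))) with m_h := −1/(4c·sin²(β/2)), and on every vertical edge, h(m,n) − h(m,n+1) = H/(m_v·(g(m,n) − g(m,n+1))) with m_v := 1/(4c·sin²(β/2)); that is, (h, g) is a Weierstrass data pair for a discrete cmc-H surface (the discrete Delaunay-type surface). -/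
theorem stmt14_aux (X Y H K : ℂ) (hH : H ≠ 0) (hK : K ≠ 0) (h : X * Y = H * K) :
    X = H / ((1 / K) * Y) := by
  have hY : Y ≠ 0 := by
    rintro rfl
    rw [mul_zero] at h
    exact mul_ne_zero hH hK h.symm
  field_simp
  linear_combination h

theorem stmt14 (N : ℤ) (hN : 2 ≤ N) (β α c H : ℝ)
    (hβ : β = Real.pi / (N : ℝ))
    (hα : 0 ≤ α) (hcosh : Real.cosh α = 2 - Real.cos β)
    (hc : c ≠ 0) (hH : H ≠ 0) :
    let g : ℤ → ℤ → ℂ := fun m n =>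
      ((c * Real.exp (-(α * (m : ℝ))) : ℝ) : ℂ) *
        (((Real.cos (β * (n : ℝ)) : ℝ) : ℂ) + Complex.I * ((Real.sin (β * (n : ℝ)) : ℝ) : ℂ))
    let h : ℤ → ℤ → ℂ := fun m n =>
      ((H * Real.exp (α * (m : ℝ)) : ℝ) : ℂ) *
        (((Real.cos (β * (n : ℝ)) : ℝ) : ℂ) - Complex.I * ((Real.sin (β * (n : ℝ)) : ℝ) : ℂ))
    ∀ m n : ℤ,
      (h m n - h (m + 1) n =
        (H : ℂ) / ((((-(1 / (4 * c * Real.sin (β / 2) ^ 2)) : ℝ)) : ℂ) *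
          (g m n - g (m + 1) n))) ∧
      (h m n - h m (n + 1) =
        (H : ℂ) / ((((1 / (4 * c * Real.sin (β / 2) ^ 2) : ℝ)) : ℂ) *
          (g m n - g m (n + 1)))) := by
  intro g h m n
  have hN' : (2 : ℝ) ≤ (N : ℝ) := by exact_mod_cast hN
  have hs : Real.sin (β / 2) ≠ 0 := by
    apply ne_of_gt
    have h0 : 0 < β := by rw [hβ]; exact div_pos Real.pi_pos (by linarith)
    have h1 : β ≤ Real.pi := by
      rw [hβ]
      exact div_le_self Real.pi_pos.le (by linarith)
    apply Real.sin_pos_of_pos_of_lt_pi <;> linarith [Real.pi_pos]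
  have hcos : Real.cos β = 1 - 2 * Real.sin (β / 2) ^ 2 := by
    have h1 := Real.cos_two_mul (β / 2)
    rw [show 2 * (β / 2) = β by ring] at h1
    have h2 := Real.sin_sq_add_cos_sq (β / 2)
    linarith
  have hK : 4 * c * Real.sin (β / 2) ^ 2 ≠ 0 := by positivity
  have hKc : ((4 * c * Real.sin (β / 2) ^ 2 : ℝ) : ℂ) ≠ 0 := by exact_mod_cast hK
  have hHc : (H : ℂ) ≠ 0 := by exact_mod_cast hH
  have hab : Real.exp α + Real.exp (-α) = 2 + 4 * Real.sin (β / 2) ^ 2 := by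
    rw [Real.cosh_eq] at hcosh
    linarith
  have hab1 : Real.exp α * Real.exp (-α) = 1 := by rw [← Real.exp_add]; simp
  have hpq : Real.exp (α * (m : ℝ)) * Real.exp (-(α * (m : ℝ))) = 1 := by
    rw [← Real.exp_add]; simp
  have hp : Real.exp (α * ((m : ℝ) + 1)) = Real.exp (α * (m : ℝ)) * Real.exp α := by
    rw [← Real.exp_add]; ring_nf
  have hq : Real.exp (-(α * ((m : ℝ) + 1))) = Real.exp (-(α * (m : ℝ))) * Real.exp (-α) := by
    rw [← Real.exp_add]; ring_nf
  have hcn : Real.cos (β * ((n : ℝ) + 1)) = Real.cos (β * (n : ℝ)) * Real.cos β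
      - Real.sin (β * (n : ℝ)) * Real.sin β := by
    rw [mul_add, mul_one, Real.cos_add]
  have hsn : Real.sin (β * ((n : ℝ) + 1)) = Real.sin (β * (n : ℝ)) * Real.cos β
      + Real.cos (β * (n : ℝ)) * Real.sin β := by
    rw [mul_add, mul_one, Real.sin_add]
  have h1 := Real.sin_sq_add_cos_sq (β * (n : ℝ))
  have h2 := Real.sin_sq_add_cos_sq β
  have hI := Complex.I_sq
  simp only [g, h, Int.cast_add, Int.cast_one, hp, hq, hcn, hsn]
  generalize Real.cos (β * (n : ℝ)) = C at *
  generalize Real.sin (β * (n : ℝ)) = S at *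
  generalize Real.exp (α * (m : ℝ)) = p at *
  generalize Real.exp (-(α * (m : ℝ))) = q at *
  generalize Real.exp α = a at *
  generalize Real.exp (-α) = b at *
  generalize Real.cos β = u at *
  generalize Real.sin β = v at *
  generalize Real.sin (β / 2) = s at *
  have hcos' := congrArg Complex.ofReal hcos
  have hab' := congrArg Complex.ofReal hab
  have hab1' := congrArg Complex.ofReal hab1
  have hpq' := congrArg Complex.ofReal hpq
  have h1' := congrArg Complex.ofReal h1
  have h2' := congrArg Complex.ofReal h2
  push_cast at hcos' hab' hab1' hpq' h1' h2'
  have e1 : ((C : ℂ) - Complex.I * S) * (C + Complex.I * S) = 1 := by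
    linear_combination h1' - (S : ℂ) ^ 2 * hI
  have e2 : ((u : ℂ) - Complex.I * v) * (u + Complex.I * v) = 1 := by
    linear_combination h2' - (v : ℂ) ^ 2 * hI
  constructor
  · have key := stmt14_aux
      (((H * p : ℝ) : ℂ) * ((C : ℂ) - Complex.I * S)
        - ((H * (p * a) : ℝ) : ℂ) * ((C : ℂ) - Complex.I * S))
      (-(((c * q : ℝ) : ℂ) * ((C : ℂ) + Complex.I * S)
        - ((c * (q * b) : ℝ) : ℂ) * ((C : ℂ) + Complex.I * S)))
      H _ hHc hKc (by
        have e3 : (1 - (a : ℂ)) * (1 - b) = - (4 * (s : ℂ) ^ 2) := by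
          linear_combination hab1' - hab'
        push_cast
        calc _ = -((H : ℂ) * c * (p * q) * (((C : ℂ) - Complex.I * S) * (C + Complex.I * S))
                * ((1 - (a : ℂ)) * (1 - b))) := by ring
          _ = _ := by rw [hpq', e1, e3]; ring)
    rw [key]
    push_cast
    congr 1
    ring
  · have key := stmt14_aux
      (((H * p : ℝ) : ℂ) * ((C : ℂ) - Complex.I * S)
        - ((H * p : ℝ) : ℂ) * (((C * u - S * v : ℝ) : ℂ) - Complex.I * ((S * u + C * v : ℝ) : ℂ)))
      (((c * q : ℝ) : ℂ) * ((C : ℂ) + Complex.I * S)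
        - ((c * q : ℝ) : ℂ) * (((C * u - S * v : ℝ) : ℂ) + Complex.I * ((S * u + C * v : ℝ) : ℂ)))
      H _ hHc hKc (by
        have f1 : (C * u - S * v : ℂ) - Complex.I * (S * u + C * v)
            = (C - Complex.I * S) * (u - Complex.I * v) := by
          linear_combination -(S * v : ℂ) * hI
        have f2 : (C * u - S * v : ℂ) + Complex.I * (S * u + C * v)
            = (C + Complex.I * S) * (u + Complex.I * v) := by
          linear_combination -(S * v : ℂ) * hI
        have e3 : (1 - ((u : ℂ) - Complex.I * v)) * (1 - (u + Complex.I * v))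
            = 4 * (s : ℂ) ^ 2 := by
          linear_combination e2 - 2 * hcos'
        push_cast
        rw [f1, f2]
        calc _ = ((H : ℂ) * c * (p * q) * (((C : ℂ) - Complex.I * S) * (C + Complex.I * S))
                * ((1 - ((u : ℂ) - Complex.I * v)) * (1 - (u + Complex.I * v)))) := by ring
          _ = _ := by rw [hpq', e1, e3]; ring)
    rw [key]
    push_cast
    rfl
end

section
/- Let N ∈ ℤ with N ≥ 2, set β := π/N, let α ≥ 0 be the real number with cosh α = 2 − cos β, and let c, H ∈ ℝ \ {0}. Define g(m,n) := c·e^{−αm}(cos(βn) + 𝕚 sin(βn)), h(m,n) := H·e^{αm}(cos(βn) − 𝕚 sin(βn)), and Y(m,n) := ( (H/2)e^{2αm} + c·sinh(α)·m, e^{αm}cos(βn), −e^{αm}sin(βn) ) ∈ ℝ³. Then on every horizontal edge, Y(m,n) − Y(m+1,n) = (1/H)·( Re(c_e·δ), Re δ, Re(−𝕚 δ) ) with δ := h(m,n) − h(m+1,n) and c_e := conj((h(m,n) + h(m+1,n))/2) + (g(m,n) + g(m+1,n))/2, and the analogous identity holds on every vertical edge. In particular, Y(m,n) − Y(m+1,n)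 = ( −sinh(α)(H e^{α(2m+1)} + c), (e^{αm} − e^{α(m+1)})cos(βn), −(e^{αm} − e^{α(m+1)})sin(βn) ) and Y(m,n) − Y(m,n+1) = ( 0, e^{αm}(cos(βn) − cos(β(n+1))), −e^{αm}(sin(βn) − sin(β(n+1))) ); so Y is the closed-form parametrization of a discrete Delaunay-type surface of revolution with period 2N. -/
theorem stmt15 (N : ℤ) (hN : 2 ≤ N) (β α c H : ℝ)
    (hβ : β = Real.pi / (N : ℝ))
    (hα : 0 ≤ α) (hcosh : Real.cosh α = 2 - Real.cos β)
    (hc : c ≠ 0) (hH : H ≠ 0) :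
    let g : ℤ → ℤ → ℂ := fun m n =>
      ((c * Real.exp (-(α * (m : ℝ))) : ℝ) : ℂ) *
        (((Real.cos (β * (n : ℝ)) : ℝ) : ℂ) + Complex.I * ((Real.sin (β * (n : ℝ)) : ℝ) : ℂ))
    let h : ℤ → ℤ → ℂ := fun m n =>
      ((H * Real.exp (α * (m : ℝ)) : ℝ) : ℂ) *
        (((Real.cos (β * (n : ℝ)) : ℝ) : ℂ) - Complex.I * ((Real.sin (β * (n : ℝ)) : ℝ) : ℂ))
    let Y : ℤ → ℤ → ℝ × ℝ × ℝ := fun m n =>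
      ((H / 2) * Real.exp (2 * α * (m : ℝ)) + c * Real.sinh α * (m : ℝ),
        Real.exp (α * (m : ℝ)) * Real.cos (β * (n : ℝ)),
        -(Real.exp (α * (m : ℝ)) * Real.sin (β * (n : ℝ))))
    ∀ m n : ℤ,
      (Y m n - Y (m + 1) n = wform H (h m n) (h (m + 1) n) (g m n) (g (m + 1) n)) ∧
      (Y m n - Y m (n + 1) = wform H (h m n) (h m (n + 1)) (g m n) (g m (n + 1))) ∧
      (Y m n - Y (m + 1) n =
        (-(Real.sinh α * (H * Real.exp (α * (2 * (m : ℝ) + 1)) + c)),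
          (Real.exp (α * (m : ℝ)) - Real.exp (α * ((m : ℝ) + 1))) * Real.cos (β * (n : ℝ)),
          -((Real.exp (α * (m : ℝ)) - Real.exp (α * ((m : ℝ) + 1))) * Real.sin (β * (n : ℝ))))) ∧
      (Y m n - Y m (n + 1) =
        ((0 : ℝ),
          Real.exp (α * (m : ℝ)) * (Real.cos (β * (n : ℝ)) - Real.cos (β * ((n : ℝ) + 1))),
          -(Real.exp (α * (m : ℝ)) * (Real.sin (β * (n : ℝ)) - Real.sin (β * ((n : ℝ) + 1)))))) := by
  intro g h Y m n
  have e1 : Real.exp (α * ((m : ℝ) + 1)) = Real.exp (α * m) * Real.exp α := by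
    rw [← Real.exp_add]; ring_nf
  have e2 : Real.exp (-(α * ((m : ℝ) + 1))) = Real.exp (-(α * m)) * Real.exp (-α) := by
    rw [← Real.exp_add]; ring_nf
  have e3 : Real.exp (2 * α * (m : ℝ)) = Real.exp (α * m) ^ 2 := by
    rw [sq, ← Real.exp_add]; ring_nf
  have e4 : Real.exp (2 * α * ((m : ℝ) + 1)) = (Real.exp (α * m) * Real.exp α) ^ 2 := by
    rw [← Real.exp_add, sq, ← Real.exp_add]; ring_nf
  have e5 : Real.exp (α * (2 * (m : ℝ) + 1)) = Real.exp (α * m) ^ 2 * Real.exp α := by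
    rw [sq, ← Real.exp_add, ← Real.exp_add]; ring_nf
  have i1 : Real.exp (α * m) * Real.exp (-(α * m)) = 1 := by
    rw [← Real.exp_add]; simp
  have i2 : Real.exp α * Real.exp (-α) = 1 := by
    rw [← Real.exp_add]; simp
  have t1 := Real.sin_sq_add_cos_sq (β * (n : ℝ))
  have t2 := Real.sin_sq_add_cos_sq (β * ((n : ℝ) + 1))
  have hs := Real.sinh_eq α
  simp only [g, h, Y, wform, Int.cast_add, Int.cast_one, e1, e2, e3, e4, e5, hs]
  clear hcosh hs e1 e2 e3 e4 e5 g h Y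
  generalize Real.exp (α * m) = E at *
  generalize Real.exp (-(α * m)) = E' at *
  generalize Real.exp α = A at *
  generalize Real.exp (-α) = A' at *
  generalize Real.sin (β * (n : ℝ)) = s at *
  generalize Real.cos (β * (n : ℝ)) = k at *
  generalize Real.sin (β * ((n : ℝ) + 1)) = s' at *
  generalize Real.cos (β * ((n : ℝ) + 1)) = k' at *
  have half : ∀ z : ℂ, z / 2 = ((1 / 2 : ℝ) : ℂ) * z := by
    intro z; push_cast; ring
  simp only [half]
  refine ⟨?_, ?_, ?_, ?_⟩
  all_goals
    simp only [Prod.mk_sub_mk, Prod.smul_mk, smul_eq_mul, Prod.mk.injEq]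
    refine ⟨?_, ?_, ?_⟩
  all_goals
    try simp only [Complex.mul_re, Complex.mul_im, Complex.add_re, Complex.add_im, Complex.sub_re,
      Complex.sub_im, Complex.ofReal_re, Complex.ofReal_im, Complex.I_re, Complex.I_im,
      Complex.conj_re, Complex.conj_im, Complex.neg_re, Complex.neg_im, one_div_mul_eq_div]
    try field_simp
    try grind
end

section
/- Let β ∈ ℝ with cos β ≠ 1, let α ≥ 0 be the real number with cosh α = 2 − cos β, and let c ∈ ℂ \ {0}. Define the discrete exponential function g(m,n) := c·e^{−αm}(cos(βn) + 𝕚 sin(βn)) for (m,n) ∈ ℤ². Then on every elementary quadrilateral, the vertices g(m,n), g(m+1,n), g(m+1,n+1), g(m,n+1) are pairwise distinct and cr( g(m,n), g(m+1,n), g(m+1,n+1), g(m,n+1) ) = −1; that is, g is a discrete holomorphic function with all cross-ratios equal to −1. -/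
theorem stmt16 (β α : ℝ) (hβ : Real.cos β ≠ 1)
    (hα : 0 ≤ α) (hcosh : Real.cosh α = 2 - Real.cos β)
    (c : ℂ) (hc : c ≠ 0) :
    let g : ℤ → ℤ → ℂ := fun m n =>
      c * ((Real.exp (-(α * (m : ℝ))) : ℝ) : ℂ) *
        (((Real.cos (β * (n : ℝ)) : ℝ) : ℂ) + Complex.I * ((Real.sin (β * (n : ℝ)) : ℝ) : ℂ))
    ∀ m n : ℤ,
      g m n ≠ g (m + 1) n ∧
      g m n ≠ g (m + 1) (n + 1) ∧
      g m n ≠ g m (n + 1) ∧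
      g (m + 1) n ≠ g (m + 1) (n + 1) ∧
      g (m + 1) n ≠ g m (n + 1) ∧
      g (m + 1) (n + 1) ≠ g m (n + 1) ∧
      cr (g m n) (g (m + 1) n) (g (m + 1) (n + 1)) (g m (n + 1)) = -1 := by
  intro g m n
  obtain ⟨r, hr⟩ : ∃ r : ℂ, r = ((Real.exp (-α) : ℝ) : ℂ) := ⟨_, rfl⟩
  obtain ⟨w, hw⟩ : ∃ w : ℂ, w = ((Real.cos β : ℝ) : ℂ) + Complex.I * ((Real.sin β : ℝ) : ℂ) :=
    ⟨_, rfl⟩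
  obtain ⟨C, hC⟩ : ∃ C : ℂ, C = ((Real.cos β : ℝ) : ℂ) := ⟨_, rfl⟩
  have hC1 : C - 1 ≠ 0 := by
    rw [hC, sub_ne_zero]; exact_mod_cast hβ
  have hr0 : r ≠ 0 := by
    rw [hr]; exact_mod_cast (Real.exp_pos _).ne'
  have hrr : r ^ 2 + 1 = 2 * r * (2 - C) := by
    have h : (Real.exp (-α)) ^ 2 + 1 = 2 * Real.exp (-α) * (2 - Real.cos β) := by
      rw [← hcosh, Real.cosh_eq]
      have : Real.exp (-α) * Real.exp α = 1 := by rw [← Real.exp_add]; simp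
      linear_combination -this
    rw [hr, hC]; exact_mod_cast h
  have hsc : ((Real.sin β : ℝ) : ℂ) ^ 2 + ((Real.cos β : ℝ) : ℂ) ^ 2 = 1 := by
    exact_mod_cast Real.sin_sq_add_cos_sq β
  have hww : w ^ 2 + 1 = 2 * w * C := by
    rw [hw, hC]
    linear_combination ((Real.sin β : ℝ) : ℂ) ^ 2 * Complex.I_sq - hsc
  have hw0 : w ≠ 0 := by
    rintro h; rw [h] at hww; norm_num at hww
  have hm : ∀ n, g (m + 1) n = r * g m n := by
    intro n
    have : Real.exp (-(α * ((m + 1 : ℤ) : ℝ))) = Real.exp (-α) * Real.exp (-(α * (m : ℝ))) := by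
      rw [← Real.exp_add]; push_cast; ring_nf
    simp only [g, this, hr, Complex.ofReal_mul]; ring
  have hn : g m (n + 1) = w * g m n := by
    have e : β * ((n + 1 : ℤ) : ℝ) = β * (n : ℝ) + β := by push_cast; ring
    simp only [g, e, Real.cos_add, Real.sin_add, hw, Complex.ofReal_mul, Complex.ofReal_add,
      Complex.ofReal_sub]
    linear_combination (-c * ((Real.exp (-(α * (m : ℝ))) : ℝ) : ℂ) *
      ((Real.sin (β * (n : ℝ)) : ℝ) : ℂ) * ((Real.sin β : ℝ) : ℂ)) * Complex.I_sq
  have hG : g m n ≠ 0 := by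
    have h2 : ((Real.sin (β * n) : ℝ) : ℂ) ^ 2 + ((Real.cos (β * n) : ℝ) : ℂ) ^ 2 = 1 := by
      exact_mod_cast Real.sin_sq_add_cos_sq (β * n)
    refine mul_ne_zero (mul_ne_zero hc ?_) ?_
    · exact_mod_cast (Real.exp_pos _).ne'
    · intro h
      have : (1 : ℂ) = 0 := by
        linear_combination (((Real.cos (β * (n : ℝ)) : ℝ) : ℂ) -
          Complex.I * ((Real.sin (β * (n : ℝ)) : ℝ) : ℂ)) * h - h2 +
          ((Real.sin (β * (n : ℝ)) : ℝ) : ℂ) ^ 2 * Complex.I_sq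
      exact one_ne_zero this
  rw [hm, hm, hn]
  generalize g m n = G at hG
  have r1 : r - 1 ≠ 0 := by
    intro h
    obtain rfl : r = 1 := sub_eq_zero.1 h
    exact hC1 (by linear_combination hrr / 2)
  have w1 : w - 1 ≠ 0 := by
    intro h
    obtain rfl : w = 1 := sub_eq_zero.1 h
    exact hC1 (by linear_combination -hww / 2)
  have rw1 : r * w - 1 ≠ 0 := by
    intro h
    have : r * (C - 1) = 0 := by
      linear_combination (hrr - r ^ 2 * hww + (r * w + 1 - 2 * r * C) * h) / 4
    exact (mul_ne_zero hr0 hC1) this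
  have rw2 : r - w ≠ 0 := by
    intro h
    obtain rfl : r = w := sub_eq_zero.1 h
    exact (mul_ne_zero hr0 hC1) (by linear_combination (hrr - hww) / 4)
  refine ⟨fun h => mul_ne_zero r1 hG ?_, fun h => mul_ne_zero rw1 hG ?_,
    fun h => mul_ne_zero w1 hG ?_, fun h => mul_ne_zero (mul_ne_zero hr0 w1) hG ?_,
    fun h => mul_ne_zero rw2 hG ?_, fun h => mul_ne_zero (mul_ne_zero r1 hw0) hG ?_, ?_⟩
  · linear_combination -h
  · linear_combination -h
  · linear_combination -h
  · linear_combination -h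
  · linear_combination h
  · linear_combination h
  · unfold cr
    have hd : (r * G - r * (w * G)) * (w * G - G) ≠ 0 := by
      have : (r * G - r * (w * G)) * (w * G - G) = -(r * G * (w - 1) * ((w - 1) * G)) := by ring
      rw [this]
      exact neg_ne_zero.2 (mul_ne_zero (mul_ne_zero (mul_ne_zero hr0 hG) w1) (mul_ne_zero w1 hG))
    rw [div_eq_iff hd]
    linear_combination -G ^ 2 * (w * hrr + r * hww)
end
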